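/- arXiv:2605.11745 — 2 statements merged into one kernel-verified Lean document; each statement's English description precedes it below -/
import Mathlib

section
/- Every element of W̃SO(2n) is a unimodular scalar multiple of an element of the λ = 1 special form; precisely, {M ∈ U(2n) : ∃ λ ∈ ℂ, |λ| = 1, M C_{2n} M^t C_{2n}^t = λ I_{2n} and det M = λ^n} = {μ N : μ ∈ ℂ, |μ| = 1, N ∈ U(2n), N C_{2n} N^t C_{2n}^t = I_{2n}, det N = 1}. -/
open Matrix

/-- The `2n × 2n` anti-diagonal matrix `(C_{2n})_{i,j} = δ_{j, 2n+1−i}` (1-based). -/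
noncomputable def Cmat (n : ℕ) : Matrix (Fin n) (Fin n) ℂ :=
  Matrix.of fun i j => if (i : ℕ) + (j : ℕ) + 1 = n then 1 else 0

lemma smul_mem_unitary_aux {m : ℕ} {c : ℂ} (hc : ‖c‖ = 1) {M : Matrix (Fin m) (Fin m) ℂ}
    (hM : M ∈ Matrix.unitaryGroup (Fin m) ℂ) : c • M ∈ Matrix.unitaryGroup (Fin m) ℂ := by
  rw [Matrix.mem_unitaryGroup_iff] at hM ⊢
  have h : c * star c = 1 := by
    have := Complex.mul_conj' c
    rw [hc] at this
    simpa using this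
  rw [star_smul, Matrix.smul_mul, Matrix.mul_smul, hM, smul_smul, h, one_smul]

lemma smul_form_aux {m : ℕ} (c : ℂ) (M C : Matrix (Fin m) (Fin m) ℂ) :
    (c • M) * C * (c • M)ᵀ * Cᵀ = (c ^ 2) • (M * C * Mᵀ * Cᵀ) := by
  simp only [Matrix.transpose_smul, Matrix.smul_mul, Matrix.mul_smul, smul_smul, pow_two]

/-- every element of `W̃SO(2n)` is a unimodular scalar multiple of an element
of the `λ = 1` special form, and conversely. -/
theorem stmt8 (n : ℕ) :
    {M : Matrix (Fin (2 * n)) (Fin (2 * n)) ℂ |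
        M ∈ Matrix.unitaryGroup (Fin (2 * n)) ℂ ∧
        ∃ lam : ℂ, ‖lam‖ = 1 ∧
          M * Cmat (2 * n) * Mᵀ * (Cmat (2 * n))ᵀ
            = lam • (1 : Matrix (Fin (2 * n)) (Fin (2 * n)) ℂ) ∧
          M.det = lam ^ n} =
      {P : Matrix (Fin (2 * n)) (Fin (2 * n)) ℂ |
        ∃ (mu : ℂ) (N : Matrix (Fin (2 * n)) (Fin (2 * n)) ℂ),
          ‖mu‖ = 1 ∧ N ∈ Matrix.unitaryGroup (Fin (2 * n)) ℂ ∧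
          N * Cmat (2 * n) * Nᵀ * (Cmat (2 * n))ᵀ = 1 ∧ N.det = 1 ∧ P = mu • N} := by
  ext M
  simp only [Set.mem_setOf_eq]
  constructor
  · rintro ⟨hM, lam, hl, hf, hd⟩
    obtain ⟨mu, hmu⟩ := IsSquare.exists_sq lam (IsAlgClosed.exists_pow_nat_eq lam
      (n := 2) (by norm_num) |>.elim fun z hz => ⟨z, by rw [← hz, pow_two]⟩)
    have hmu1 : ‖mu‖ = 1 := by
      rw [hmu, norm_pow] at hl
      exact (pow_eq_one_iff_of_nonneg (norm_nonneg _) (by norm_num)).1 hl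
    have h0 : mu ≠ 0 := by
      rintro rfl
      simp at hmu1
    refine ⟨mu, mu⁻¹ • M, hmu1, smul_mem_unitary_aux (by simp [hmu1]) hM, ?_, ?_, ?_⟩
    · rw [smul_form_aux, hf, smul_smul, hmu, ← mul_pow, inv_mul_cancel₀ h0, one_pow, one_smul]
    · rw [Matrix.det_smul, hd, hmu, Fintype.card_fin, ← pow_mul, ← mul_pow, inv_mul_cancel₀ h0,
        one_pow]
    · rw [smul_smul, mul_inv_cancel₀ h0, one_smul]
  · rintro ⟨mu, N, hmu, hN, hf, hd, rfl⟩
    refine ⟨smul_mem_unitary_aux hmu hN, mu ^ 2, by simp [hmu], ?_, ?_⟩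
    · rw [smul_form_aux, hf]
    · rw [Matrix.det_smul, hd, Fintype.card_fin, mul_one, pow_mul]
end

section
/- Let H be a nonzero complex Hilbert space and let S be a set of bounded linear operators on H that is closed under taking adjoints, such that the only closed subspaces of H invariant under every element of S are {0} and H (topological irreducibility). If U is a unitary bounded operator on H commuting with every element of S, then there exists μ ∈ ℂ with |μ| = 1 such that U = μ · id_H. -/
/-- let `H` be a nonzero complex Hilbert space and `S` a set of bounded
operators on `H` closed under adjoints, such that the only closed subspaces of `H`
invariant under every element of `S` are `{0}` and `H`. If `U` is a unitary bounded
operator commuting with every element of `S`, then `U = μ · id` for some `μ ∈ ℂ` with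
`|μ| = 1`. -/
theorem stmt17 {H : Type*} [NormedAddCommGroup H] [InnerProductSpace ℂ H]
    [CompleteSpace H] [Nontrivial H]
    (S : Set (H →L[ℂ] H))
    (hstar : ∀ T ∈ S, ContinuousLinearMap.adjoint T ∈ S)
    (hirr : ∀ V : Submodule ℂ H, IsClosed (V : Set H) →
      (∀ T ∈ S, ∀ v ∈ V, T v ∈ V) → V = ⊥ ∨ V = ⊤)
    (U : H →L[ℂ] H)
    (hU₁ : ContinuousLinearMap.adjoint U * U = 1)
    (hU₂ : U * ContinuousLinearMap.adjoint U = 1)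
    (hcomm : ∀ T ∈ S, U * T = T * U) :
    ∃ μ : ℂ, ‖μ‖ = 1 ∧ U = μ • (1 : H →L[ℂ] H) := by
  have hUu : U ∈ unitary (H →L[ℂ] H) := Unitary.mem_iff.mpr ⟨hU₁, hU₂⟩
  have hn : IsStarNormal U := ⟨by
    change star U * U = U * star U
    rw [ContinuousLinearMap.star_eq_adjoint, hU₁, hU₂]⟩
  have hc : ∀ T ∈ S, ∀ f : ℂ → ℂ, Commute (cfc f U) T := by
    intro T hT f
    have h1 : Commute U T := hcomm T hT
    have h2 : Commute (star U) T := by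
      have h3 : Commute U (star T) := hcomm _ (hstar T hT)
      simpa using h3.star_star
    exact Commute.cfc h1 h2 f
  obtain ⟨μ, hμ⟩ := spectrum.nonempty U
  have hne : ∀ z ∈ spectrum ℂ U, z = μ := by
    intro z hz
    by_contra hzμ
    have hpos : 0 < dist z μ := dist_pos.mpr hzμ
    set r : ℝ := dist z μ / 2 with hr
    let b : ℂ → ℂ → ℂ := fun c w => ((max 0 (r - dist w c) : ℝ) : ℂ)
    have hb : ∀ c, Continuous (b c) := fun c => by
      simp only [b]
      fun_prop
    have hbc : ∀ c, b c c ≠ 0 := fun c => by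
      simp only [b, dist_self, sub_zero, ne_eq, Complex.ofReal_eq_zero]
      rw [max_eq_right (by positivity)]
      positivity
    have hb0 : ∀ c ∈ spectrum ℂ U, cfc (b c) U ≠ 0 := by
      intro c hcs h0
      have hm : b c c ∈ spectrum ℂ (cfc (b c) U) := by
        rw [cfc_map_spectrum (b c) U hn (hb c).continuousOn]
        exact ⟨c, hcs, rfl⟩
      rw [h0, spectrum.zero_eq] at hm
      exact hbc c hm
    have hprod : cfc (b μ) U * cfc (b z) U = 0 := by
      rw [← cfc_mul (b μ) (b z) U (hb μ).continuousOn (hb z).continuousOn]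
      have : (fun w => b μ w * b z w) = fun _ => 0 := by
        funext w
        have htri := dist_triangle_left z μ w
        rcases le_total r (dist w μ) with h | h
        · simp [b, max_eq_left (sub_nonpos.mpr h)]
        · have h' : r ≤ dist w z := by linarith
          simp [b, max_eq_left (sub_nonpos.mpr h')]
      rw [this]
      exact cfc_const_zero ℂ U
    have hinv : ∀ T ∈ S, ∀ v ∈ LinearMap.ker (cfc (b μ) U).toLinearMap,
        T v ∈ LinearMap.ker (cfc (b μ) U).toLinearMap := by
      intro T hT v hv
      have hv' : cfc (b μ) U v = 0 := hv
      have := congrArg (fun A : H →L[ℂ] H => A v) (hc T hT (b μ)).eq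
      change cfc (b μ) U (T v) = 0
      simpa [hv'] using this
    rcases hirr (LinearMap.ker (cfc (b μ) U).toLinearMap) (cfc (b μ) U).isClosed_ker hinv with h | h
    · apply hb0 z hz
      ext v
      have hv : cfc (b z) U v ∈ LinearMap.ker (cfc (b μ) U).toLinearMap := by
        have := congrArg (fun A : H →L[ℂ] H => A v) hprod
        simpa using this
      rw [h] at hv
      simpa using hv
    · apply hb0 μ hμ
      ext v
      have hv : v ∈ LinearMap.ker (cfc (b μ) U).toLinearMap := by rw [h]; trivial
      simpa using hv
  refine ⟨μ, ?_, ?_⟩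
  · have := spectrum.subset_circle_of_unitary hUu hμ
    simpa using this
  · calc U = cfc (fun w : ℂ => w) U := (cfc_id' ℂ U).symm
      _ = cfc (fun _ : ℂ => μ) U := cfc_congr (fun w hw => hne w hw)
      _ = μ • 1 := by rw [cfc_const μ U, Algebra.algebraMap_eq_smul_one]
end
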